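/- Let 1 ≤ m ≤ n and 1 ≤ p ≤ n−1, let U ⊆ ℝ^m and V ⊆ ℝ^p be open sets, let P : U → ℝ^n be a smooth map whose derivative DP(x) has rank m at every x ∈ U, and let Q : V → ℝ^n ∖ {0} be a smooth map such that the derivative of ρ∘Q has rank p at every point of V, where ρ(x) = x/‖x‖. Define Φ(x,y) = Σ_{k=1}^{n} P_k(x)·Q_k(y) for (x,y) ∈ U × V. If A ⊆ U and B ⊆ V are compact sets with dim_H A + dim_H B > n, then there exists y ∈ B such that the set Δ_{Φ,y}(A) = { Φ(x,y) : x ∈ A } has positive one-dimensional Lebesgue measure. -/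

import Mathlib

open MeasureTheory
open scoped ENNReal

section Projections

open Metric Set Filter Topology Measure

open scoped RealInnerProductSpace NNReal

/-- A set of positive `s`-dimensional Hausdorff measure has positive Hausdorff content, with respect
to finite covers by closed balls. -/
theorem exists_pos_le_sum_rpow_of_hausdorffMeasure_ne_zero {X : Type*} [MetricSpace X]
    [MeasurableSpace X] [BorelSpace X] {K : Set X} {s : ℝ} (hs : 0 < s) (hK : μH[s] K ≠ 0) :
    ∃ c > 0, ∀ T : Finset (X × ℝ), (∀ b ∈ T, 0 ≤ b.2) →
      K ⊆ ⋃ b ∈ T, closedBall b.1 b.2 → c ≤ ∑ b ∈ T, b.2 ^ s := by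
  by_contra! h
  have hpos : ∀ N : ℕ, (0 : ℝ) < 1 / ((N : ℝ) + 1) := fun N => by positivity
  choose T hT0 hTK hTs using fun N : ℕ => h _ (hpos N)
  have hlim := tendsto_one_div_add_atTop_nhds_zero_nat (𝕜 := ℝ)
  apply hK
  have hdiam : ∀ (b : X × ℝ), ediam (closedBall b.1 b.2) ≤ ENNReal.ofReal (2 * b.2) := by
    intro b
    rcases le_or_gt 0 b.2 with hb | hb
    · refine ediam_le_of_forall_dist_le fun x hx y hy => ?_
      have := dist_triangle_right x y b.1
      rw [mem_closedBall] at hx hy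
      linarith
    · simp [closedBall_eq_empty.2 hb]
  have key := hausdorffMeasure_le_liminf_sum (ι := fun N => {b // b ∈ T N}) s K (l := atTop)
    (fun N : ℕ => ENNReal.ofReal (2 * (1 / ((N : ℝ) + 1)) ^ s⁻¹)) ?_
    (fun N b => closedBall b.1.1 b.1.2) ?_ ?_
  · refine le_antisymm (key.trans ?_) zero_le
    have hle : ∀ N : ℕ, ∑ b : {b // b ∈ T N}, ediam (closedBall b.1.1 b.1.2) ^ s ≤
        ENNReal.ofReal (2 ^ s * (1 / ((N : ℝ) + 1))) := by
      intro N
      calc ∑ b : {b // b ∈ T N}, ediam (closedBall b.1.1 b.1.2) ^ s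
          ≤ ∑ b : {b // b ∈ T N}, ENNReal.ofReal ((2 * b.1.2) ^ s) := by
            refine Finset.sum_le_sum fun b _ => ?_
            rw [← ENNReal.ofReal_rpow_of_nonneg (by have := hT0 N b.1 b.2; positivity) hs.le]
            exact ENNReal.rpow_le_rpow (hdiam b.1) hs.le
        _ = ENNReal.ofReal (∑ b ∈ T N, (2 * b.2) ^ s) := by
            rw [Finset.sum_coe_sort (T N) (fun b => ENNReal.ofReal ((2 * b.2) ^ s)),
              ENNReal.ofReal_sum_of_nonneg]
            intro b hb
            have := hT0 N b hb
            positivity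
        _ ≤ _ := by
            apply ENNReal.ofReal_le_ofReal
            rw [Finset.sum_congr rfl fun b hb => Real.mul_rpow zero_le_two (hT0 N b hb),
              ← Finset.mul_sum]
            exact mul_le_mul_of_nonneg_left (hTs N).le (by positivity)
    have h0 : Tendsto (fun N : ℕ => ENNReal.ofReal (2 ^ s * (1 / ((N : ℝ) + 1)))) atTop (𝓝 0) := by
      simpa using ENNReal.tendsto_ofReal (hlim.const_mul (2 ^ s))
    rw [← h0.liminf_eq]
    exact liminf_le_liminf (Eventually.of_forall hle)
  · have : Tendsto (fun N : ℕ => 2 * (1 / ((N : ℝ) + 1)) ^ s⁻¹) atTop (𝓝 (2 * 0 ^ s⁻¹)) :=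
      (hlim.rpow_const (Or.inr (by positivity))).const_mul 2
    rw [Real.zero_rpow (by positivity), mul_zero] at this
    simpa using ENNReal.tendsto_ofReal this
  · refine Eventually.of_forall fun N b => (hdiam b.1).trans (ENNReal.ofReal_le_ofReal ?_)
    have hb0 := hT0 N b.1 b.2
    gcongr
    rw [Real.le_rpow_inv_iff_of_pos hb0 (hpos N).le hs]
    exact (Finset.single_le_sum (f := fun b : X × ℝ => b.2 ^ s)
      (fun b hb => Real.rpow_nonneg (hT0 N b hb) s) b.2).trans (hTs N).le
  · refine Eventually.of_forall fun N x hx => ?_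
    obtain ⟨b, hb, hxb⟩ := mem_iUnion₂.1 (hTK N hx)
    exact mem_iUnion.2 ⟨⟨b, hb⟩, hxb⟩

/-- A maximal weight on a finite metric space whose balls of radius `r ≥ δ` have mass at most `r ^ s`
is such that each point lies in a ball where the bound is attained. -/
theorem exists_weight_forall_mem_saturated_ball {X : Type*} [MetricSpace X] (S : Finset X)
    {s δ : ℝ} (hδ : 0 < δ) :
    ∃ w : X → ℝ, (∀ x, 0 ≤ w x) ∧
      (∀ a ∈ S, ∀ b ∈ S, ∑ y ∈ S with dist y a ≤ max δ (dist b a), w y ≤ max δ (dist b a) ^ s) ∧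
      ∀ x ∈ S, ∃ a ∈ S, ∃ b ∈ S, dist x a ≤ max δ (dist b a) ∧
        ∑ y ∈ S with dist y a ≤ max δ (dist b a), w y = max δ (dist b a) ^ s := by
  classical
  let F : Set (S → ℝ) := {w | (∀ x, 0 ≤ w x) ∧ ∀ a b : S,
    ∑ y : S with dist y a ≤ max δ (dist b a), w y ≤ max δ (dist b a) ^ s}
  have hFclosed : IsClosed F := by
    have : F = (⋂ x, {w | 0 ≤ w x}) ∩ ⋂ a : S, ⋂ b : S, {w : S → ℝ |
      ∑ y : S with dist y a ≤ max δ (dist b a), w y ≤ max δ (dist b a) ^ s} := by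
      ext w; simp [F]
    rw [this]
    refine (isClosed_iInter fun x => isClosed_le continuous_const (continuous_apply x)).inter
      (isClosed_iInter fun a => isClosed_iInter fun b => isClosed_le ?_ continuous_const)
    exact continuous_finsetSum _ fun y _ => continuous_apply y
  have hFsub : F ⊆ Icc 0 (fun _ => δ ^ s) := by
    intro w hw
    refine ⟨fun x => hw.1 x, fun x => ?_⟩
    have h1 := hw.2 x x
    simp only [dist_self, max_eq_left hδ.le] at h1
    refine le_trans ?_ h1
    exact Finset.single_le_sum (f := w) (fun y _ => hw.1 y) (by simp [hδ.le])
  have hFc : IsCompact F := isCompact_Icc.of_isClosed_subset hFclosed hFsub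
  have hF0 : (0 : S → ℝ) ∈ F := by
    refine ⟨fun x => le_rfl, fun a b => ?_⟩
    simp only [Pi.zero_apply, Finset.sum_const_zero]
    positivity
  obtain ⟨w, hwF, hwmax⟩ := hFc.exists_isMaxOn ⟨0, hF0⟩ (f := fun w => ∑ x, w x)
    (continuous_finsetSum _ fun y _ => continuous_apply y).continuousOn
  have hsum : ∀ (p : X → Prop) [DecidablePred p],
      ∑ y ∈ S with p y, (if h : y ∈ S then w ⟨y, h⟩ else 0) =
        ∑ y ∈ (Finset.univ : Finset S) with p y.1, w y := by
    intro p _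
    rw [Finset.sum_filter, Finset.sum_filter, ← Finset.sum_coe_sort S]
    refine Finset.sum_congr rfl fun y _ => ?_
    simp
  refine ⟨fun x => if h : x ∈ S then w ⟨x, h⟩ else 0, fun x => ?_, fun a ha b hb => ?_,
    fun x hx => ?_⟩
  · dsimp only
    split_ifs with h
    exacts [hwF.1 _, le_rfl]
  · rw [hsum]
    exact hwF.2 ⟨a, ha⟩ ⟨b, hb⟩
  · by_contra! hcon
    have hslack : ∀ a b : S, dist x a ≤ max δ (dist b a) →
        ∑ y : S with dist y a ≤ max δ (dist b a), w y < max δ (dist b a) ^ s := by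
      intro a b hxa
      refine lt_of_le_of_ne (hwF.2 a b) ?_
      have := hcon a a.2 b b.2 hxa
      rwa [hsum] at this
    let x' : S := ⟨x, hx⟩
    let g : ℝ → S → ℝ := fun ε y => w y + if y = x' then ε else 0
    have hg : ∀ᶠ ε in 𝓝[>] (0 : ℝ), g ε ∈ F := by
      have h1 : ∀ᶠ ε in 𝓝[>] (0 : ℝ), ∀ a b : S,
          ∑ y : S with dist y a ≤ max δ (dist b a), g ε y ≤ max δ (dist b a) ^ s := by
        rw [eventually_all]; intro a; rw [eventually_all]; intro b
        by_cases hxa : dist x a ≤ max δ (dist b a)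
        · have hc : Tendsto (fun ε => ∑ y : S with dist y a ≤ max δ (dist b a), g ε y) (𝓝[>] 0)
              (𝓝 (∑ y : S with dist y a ≤ max δ (dist b a), g 0 y)) := by
            refine (Continuous.tendsto ?_ 0).mono_left nhdsWithin_le_nhds
            refine continuous_finsetSum _ fun y _ => ?_
            dsimp only [g]
            split_ifs <;> fun_prop
          have h0 : ∑ y : S with dist y a ≤ max δ (dist b a), g 0 y < max δ (dist b a) ^ s := by
            simpa [g] using hslack a b hxa
          exact (hc.eventually (gt_mem_nhds h0)).mono fun ε h => h.le
        · refine Eventually.of_forall fun ε => ?_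
          refine le_trans (le_of_eq ?_) (hwF.2 a b)
          refine Finset.sum_congr rfl fun y hy => ?_
          have : y ≠ x' := by
            rintro rfl
            exact hxa (Finset.mem_filter.1 hy).2
          simp [g, this]
      filter_upwards [h1, self_mem_nhdsWithin] with ε h2 h3
      refine ⟨fun y => ?_, h2⟩
      have := hwF.1 y
      have h3 : (0 : ℝ) < ε := h3
      dsimp only [g]
      split_ifs <;> linarith
    obtain ⟨ε, hεF, hε⟩ := (hg.and self_mem_nhdsWithin).exists
    have h4 : ∑ y, g ε y ≤ ∑ y, w y := hwmax hεF
    have h5 : ∑ y, g ε y = ∑ y, w y + ε := by simp [g, Finset.sum_add_distrib]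
    have hε : (0 : ℝ) < ε := hε
    linarith

/-- A discretised form of Frostman's lemma: at every scale `δ`, a compact set of positive
`s`-dimensional Hausdorff measure carries a finitely supported weight of mass bounded below, for
which a ball of radius `r ≥ δ` has mass `O(r ^ s)`. -/
theorem exists_finset_weight_of_hausdorffMeasure_ne_zero {X : Type*} [MetricSpace X]
    [MeasurableSpace X] [BorelSpace X] {K : Set X} (hKc : IsCompact K) {s : ℝ} (hs : 0 < s)
    (hK : μH[s] K ≠ 0) :
    ∃ c > 0, ∀ δ > 0, ∃ (S : Finset X) (w : X → ℝ), (S : Set X) ⊆ K ∧ (∀ x, 0 ≤ w x) ∧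
      c ≤ ∑ x ∈ S, w x ∧ ∀ x r, δ ≤ r → ∑ y ∈ S with dist y x ≤ r, w y ≤ 2 ^ s * r ^ s := by
  classical
  obtain ⟨c, hc, hcov⟩ := exists_pos_le_sum_rpow_of_hausdorffMeasure_ne_zero hs hK
  refine ⟨c / 6 ^ s, by positivity, fun δ hδ => ?_⟩
  obtain ⟨t, htK, htfin, htcov⟩ := hKc.finite_cover_balls hδ
  lift t to Finset X using htfin
  obtain ⟨w, hw0, hwle, hwsat⟩ := exists_weight_forall_mem_saturated_ball t (s := s) hδ
  refine ⟨t, w, htK, hw0, ?_, fun x r hr => ?_⟩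
  · let ρ : t × t → ℝ := fun i => max δ (dist (i.2 : X) i.1)
    have hρ : ∀ i, δ ≤ ρ i := fun i => le_max_left _ _
    let T : Set (t × t) := {i | ∑ y ∈ t with dist y (i.1 : X) ≤ ρ i, w y = ρ i ^ s}
    obtain ⟨R, hR⟩ := (Set.finite_range ρ).bddAbove
    obtain ⟨u, huT, hudisj, hucov⟩ := Vitali.exists_disjoint_subfamily_covering_enlargement_closedBall
      T (fun i => (i.1 : X)) ρ R (fun i _ => hR ⟨i, rfl⟩) 5 (by norm_num)
    lift u to Finset (t × t) using Set.toFinite u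
    have h1 : K ⊆ ⋃ b ∈ u.image fun i => ((i.1 : X), 6 * ρ i), closedBall b.1 b.2 := by
      intro x hx
      obtain ⟨y, hy, hxy⟩ := mem_iUnion₂.1 (htcov hx)
      obtain ⟨a, ha, b, hb, hyab, hsat⟩ := hwsat y hy
      obtain ⟨j, hju, hj⟩ := hucov (⟨a, ha⟩, ⟨b, hb⟩) hsat
      refine mem_iUnion₂.2 ⟨((j.1 : X), 6 * ρ j), Finset.mem_image_of_mem _ hju, ?_⟩
      have h2 : dist y (j.1 : X) ≤ 5 * ρ j := hj hyab
      have h3 : dist x y < δ := hxy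
      have := dist_triangle x y (j.1 : X)
      have := hρ j
      rw [mem_closedBall]
      linarith
    have h2 := hcov _ (by
      intro b hb
      obtain ⟨i, -, rfl⟩ := Finset.mem_image.1 hb
      have := hρ i
      positivity) h1
    have h3 : ∑ b ∈ u.image (fun i => ((i.1 : X), 6 * ρ i)), b.2 ^ s ≤ ∑ i ∈ u, (6 * ρ i) ^ s := by
      refine Finset.sum_image_le_of_nonneg fun b hb => ?_
      obtain ⟨i, -, rfl⟩ := Finset.mem_image.1 hb
      have := hρ i
      positivity
    have h4 : ∑ i ∈ u, (6 * ρ i) ^ s = 6 ^ s * ∑ i ∈ u, ρ i ^ s := by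
      rw [Finset.mul_sum]
      refine Finset.sum_congr rfl fun i _ => ?_
      rw [Real.mul_rpow (by norm_num) (hδ.le.trans (hρ i))]
    have h5 : ∑ i ∈ u, ρ i ^ s ≤ ∑ x ∈ t, w x := by
      rw [Finset.sum_congr rfl fun i hi => (huT hi : _ = _).symm, ← Finset.sum_biUnion]
      · exact Finset.sum_le_sum_of_subset_of_nonneg (Finset.biUnion_subset.2 fun i _ =>
          Finset.filter_subset _ _) fun x _ _ => hw0 x
      · intro i hi j hj hij
        refine Finset.disjoint_left.2 fun y hyi hyj => ?_
        exact Set.disjoint_left.1 (hudisj hi hj hij) (Finset.mem_filter.1 hyi).2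
          (Finset.mem_filter.1 hyj).2
    rw [div_le_iff₀' (by positivity)]
    calc c ≤ _ := h2
      _ ≤ _ := h3
      _ = _ := h4
      _ ≤ _ := by gcongr
  · rcases (t.filter fun y => dist y x ≤ r).eq_empty_or_nonempty with h | ⟨a, ha⟩
    · rw [h, Finset.sum_empty]
      have : 0 < r := hδ.trans_le hr
      positivity
    · obtain ⟨b, hb, hbmax⟩ := Finset.exists_max_image (t.filter fun y => dist y x ≤ r)
        (fun y => dist y a) ⟨a, ha⟩
      have hat := (Finset.mem_filter.1 ha)
      have hbt := (Finset.mem_filter.1 hb)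
      have hba : dist b a ≤ 2 * r := by
        have := dist_triangle_right b a x
        linarith [hat.2, hbt.2]
      calc ∑ y ∈ t with dist y x ≤ r, w y ≤ ∑ y ∈ t with dist y a ≤ max δ (dist b a), w y := by
            refine Finset.sum_le_sum_of_subset_of_nonneg (fun y hy => ?_) fun x _ _ => hw0 x
            exact Finset.mem_filter.2 ⟨(Finset.mem_filter.1 hy).1,
              (hbmax y hy).trans (le_max_right _ _)⟩
        _ ≤ max δ (dist b a) ^ s := hwle a hat.1 b hbt.1
        _ ≤ (2 * r) ^ s := by
            refine Real.rpow_le_rpow (by positivity) (max_le ?_ hba) hs.le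
            linarith
        _ = _ := Real.mul_rpow zero_le_two (hδ.le.trans hr)

/-- Gaussian averages of a weight satisfying a Frostman condition at scales at least `δ`. -/
theorem exists_sum_mul_exp_le (s : ℝ) {c : ℝ} (hc : 0 < c) :
    ∃ G > 0, ∀ {X : Type*} [MetricSpace X] (S : Finset X) (w : X → ℝ) (C δ : ℝ),
      (∀ x, 0 ≤ w x) → 0 < δ → 0 ≤ C →
      (∀ x r, δ ≤ r → ∑ y ∈ S with dist y x ≤ r, w y ≤ C * r ^ s) →
      ∀ x r, δ ≤ r → ∑ y ∈ S, w y * Real.exp (-(c * (dist y x / r) ^ 2)) ≤ C * G * r ^ s := by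
  have hsum : Summable fun j : ℕ => Real.exp (-(c * (j : ℝ) ^ 2)) * ((j : ℝ) + 1) ^ s := by
    have h1 : Summable fun j : ℕ => ((j : ℝ)) ^ ⌈s⌉₊ * Real.exp (-c * j) :=
      Real.summable_pow_mul_exp_neg_nat_mul _ hc
    have h2 : Summable fun j : ℕ => Real.exp c * (((j + 1 : ℕ) : ℝ) ^ ⌈s⌉₊ *
        Real.exp (-c * (j + 1 : ℕ))) := ((summable_nat_add_iff 1).2 h1).mul_left _
    refine h2.of_nonneg_of_le (fun j => by positivity) fun j => ?_
    have h3 : ((j : ℝ) + 1) ^ s ≤ ((j + 1 : ℕ) : ℝ) ^ ⌈s⌉₊ := by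
      rw [← Real.rpow_natCast, Nat.cast_add_one]
      exact Real.rpow_le_rpow_of_exponent_le (by linarith [j.cast_nonneg (α := ℝ)]) (Nat.le_ceil s)
    have h4 : Real.exp (-(c * (j : ℝ) ^ 2)) ≤ Real.exp c * Real.exp (-c * (j + 1 : ℕ)) := by
      rw [← Real.exp_add]
      apply Real.exp_le_exp.2
      have : (j : ℝ) ≤ (j : ℝ) ^ 2 := by exact_mod_cast Nat.le_self_pow two_ne_zero j
      push_cast
      nlinarith
    calc _ ≤ (Real.exp c * Real.exp (-c * (j + 1 : ℕ))) * ((j + 1 : ℕ) : ℝ) ^ ⌈s⌉₊ := by gcongr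
      _ = _ := by ring
  refine ⟨∑' j : ℕ, Real.exp (-(c * (j : ℝ) ^ 2)) * ((j : ℝ) + 1) ^ s,
    hsum.tsum_pos (fun j => by positivity) 0 (by positivity), ?_⟩
  intro X _ S w C δ hw hδ hC hwC x r hr
  have hr0 : 0 < r := hδ.trans_le hr
  obtain ⟨J, hJ⟩ : ∃ J : ℕ, ∀ y ∈ S, ⌊dist y x / r⌋₊ < J := by
    refine ⟨S.sup (fun y => ⌊dist y x / r⌋₊) + 1, fun y hy => Nat.lt_succ_of_le ?_⟩
    exact Finset.le_sup (f := fun y => ⌊dist y x / r⌋₊) hy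
  calc ∑ y ∈ S, w y * Real.exp (-(c * (dist y x / r) ^ 2))
      ≤ ∑ y ∈ S, ∑ j ∈ Finset.range J, Real.exp (-(c * (j : ℝ) ^ 2)) *
          (if dist y x ≤ (j + 1) * r then w y else 0) := by
        refine Finset.sum_le_sum fun y hy => ?_
        have hq : 0 ≤ dist y x / r := by positivity
        refine le_trans ?_ (Finset.single_le_sum (fun j _ => ?_) (Finset.mem_range.2 (hJ y hy)))
        · have h1 : dist y x ≤ ((⌊dist y x / r⌋₊ : ℝ) + 1) * r :=
            (div_le_iff₀ hr0).1 (Nat.lt_floor_add_one _).le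
          rw [if_pos h1, mul_comm]
          have := hw y
          have := Nat.floor_le hq
          gcongr
        · have := hw y
          split_ifs <;> positivity
    _ = ∑ j ∈ Finset.range J, Real.exp (-(c * (j : ℝ) ^ 2)) *
          ∑ y ∈ S with dist y x ≤ (j + 1) * r, w y := by
        rw [Finset.sum_comm]
        simp_rw [Finset.mul_sum, Finset.sum_filter, mul_ite, mul_zero]
    _ ≤ ∑ j ∈ Finset.range J, C * r ^ s * (Real.exp (-(c * (j : ℝ) ^ 2)) * ((j : ℝ) + 1) ^ s) := by
        refine Finset.sum_le_sum fun j _ => ?_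
        have h1 := hwC x ((j + 1) * r) (by nlinarith [j.cast_nonneg (α := ℝ)])
        rw [Real.mul_rpow (by positivity) hr0.le] at h1
        calc _ ≤ Real.exp (-(c * (j : ℝ) ^ 2)) * (C * (((j : ℝ) + 1) ^ s * r ^ s)) := by gcongr
          _ = _ := by ring
    _ ≤ C * r ^ s * ∑' j : ℕ, Real.exp (-(c * (j : ℝ) ^ 2)) * ((j : ℝ) + 1) ^ s := by
        rw [← Finset.mul_sum]
        gcongr
        exact hsum.sum_le_tsum _ fun j _ => by positivity
    _ = _ := by ring

section Fourier

variable {ι V : Type*} [NormedAddCommGroup V] [InnerProductSpace ℝ V]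

/-- The Fourier transform of the finitely supported measure `∑ i ∈ S, w i • δ_{z i}`. -/
noncomputable def expSum (S : Finset ι) (w : ι → ℝ) (z : ι → V) (ξ : V) : ℂ :=
  ∑ i ∈ S, (w i : ℂ) * Complex.exp (Complex.I * (⟪z i, ξ⟫ : ℝ))

theorem continuous_expSum (S : Finset ι) (w : ι → ℝ) (z : ι → V) : Continuous (expSum S w z) := by
  unfold expSum
  fun_prop

theorem expSum_smul_eq_expSum_inner (S : Finset ι) (w : ι → ℝ) (z : ι → V) (θ : V) (r : ℝ) :
    expSum S w z (r • θ) = expSum S w (fun i => ⟪z i, θ⟫) r := by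
  simp [expSum, inner_smul_right]

theorem ofReal_exp_mul_sq_norm_expSum (S : Finset ι) (w : ι → ℝ) (z : ι → V) (a : ℝ) (η : V) :
    ((Real.exp (-a * ‖η‖ ^ 2) * ‖expSum S w z η‖ ^ 2 : ℝ) : ℂ) =
      ∑ i ∈ S, ∑ j ∈ S, ((w i * w j : ℝ) : ℂ) *
        Complex.exp (-a * ‖η‖ ^ 2 + Complex.I * (⟪z i - z j, η⟫ : ℝ)) := by
  have h1 : ((‖expSum S w z η‖ ^ 2 : ℝ) : ℂ) =
      expSum S w z η * (starRingEnd ℂ) (expSum S w z η) := by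
    rw [Complex.mul_conj, Complex.normSq_eq_norm_sq]
  rw [Complex.ofReal_mul, h1, expSum, _root_.map_sum, Finset.sum_mul_sum, Finset.mul_sum]
  refine Finset.sum_congr rfl fun i _ => ?_
  rw [Finset.mul_sum]
  refine Finset.sum_congr rfl fun j _ => ?_
  rw [map_mul, ← Complex.exp_conj, map_mul, Complex.conj_I, Complex.conj_ofReal,
    Complex.conj_ofReal, inner_sub_left, Complex.exp_add, Complex.ofReal_sub, mul_sub,
    Complex.exp_sub, div_eq_mul_inv, ← Complex.exp_neg, neg_mul, Complex.ofReal_mul]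
  push_cast
  ring_nf

theorem lintegral_exp_mul_exp_le {θ : V} (hθ : ‖θ‖ = 1) {δ : ℝ} (hδ : 0 < δ) (hδ2 : δ ≤ 1 / 2)
    (η : V) :
    ∫⁻ r : ℝ, ENNReal.ofReal (Real.exp (-δ ^ 2 * ‖r‖ ^ 2) *
        Real.exp (-(1 / 2) * ‖η - r • θ‖ ^ 2)) ≤
      ENNReal.ofReal (√(Real.pi / (1 / 4)) *
        (Real.exp (-(δ ^ 2 * ‖η‖ ^ 2 / 2)) * Real.exp (-((‖η‖ ^ 2 - ⟪η, θ⟫ ^ 2) / 4)))) := by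
  calc _ ≤ ∫⁻ r : ℝ, ENNReal.ofReal (Real.exp (-(δ ^ 2 * ‖η‖ ^ 2 / 2)) *
        Real.exp (-((‖η‖ ^ 2 - ⟪η, θ⟫ ^ 2) / 4))) *
          ENNReal.ofReal (Real.exp (-(1 / 4) * (r + -⟪η, θ⟫) ^ 2)) := by
        refine lintegral_mono fun r => ?_
        rw [← ENNReal.ofReal_mul (by positivity)]
        apply ENNReal.ofReal_le_ofReal
        rw [← Real.exp_add, ← Real.exp_add, ← Real.exp_add]
        apply Real.exp_le_exp.2
        have h1 : ‖η - r • θ‖ ^ 2 = ‖η‖ ^ 2 - 2 * (r * ⟪η, θ⟫) + r ^ 2 := by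
          rw [norm_sub_sq_real, inner_smul_right, norm_smul, hθ, mul_one, Real.norm_eq_abs, sq_abs]
        have h2 : ‖η‖ ≤ |r| + ‖η - r • θ‖ := by
          have := norm_add_le (r • θ) (η - r • θ)
          rwa [add_sub_cancel, norm_smul, hθ, mul_one, Real.norm_eq_abs] at this
        have h3 : ‖η‖ ^ 2 ≤ 2 * r ^ 2 + 2 * ‖η - r • θ‖ ^ 2 := by
          rw [← sq_abs r]
          nlinarith [norm_nonneg η, sq_nonneg (|r| - ‖η - r • θ‖)]
        have h4 : δ ^ 2 ≤ 1 / 4 := by nlinarith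
        rw [Real.norm_eq_abs, sq_abs]
        nlinarith [mul_le_mul_of_nonneg_left h3 (sq_nonneg δ),
          mul_le_mul_of_nonneg_right h4 (sq_nonneg ‖η - r • θ‖)]
    _ = _ := by
        rw [lintegral_const_mul _ (by fun_prop), lintegral_add_right_eq_self
          (fun r : ℝ => ENNReal.ofReal (Real.exp (-(1 / 4) * r ^ 2))),
          ← ofReal_integral_eq_lintegral_ofReal (integrable_exp_neg_mul_sq (by norm_num))
          (ae_of_all _ fun r => Real.exp_nonneg _), integral_gaussian, ← ENNReal.ofReal_mul
          (by positivity), mul_comm]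

/-- A point on the line of `θ` is close to `η` only if `θ` is close to one of the directions
`± η / ‖η‖`. -/
theorem exp_neg_sq_norm_sub_sq_inner_le {θ η : V} (hθ : ‖θ‖ = 1) {ρ : ℝ} (hρ : 0 < ρ)
    (h : 1 / 2 ≤ ρ * ‖η‖) :
    Real.exp (-((‖η‖ ^ 2 - ⟪η, θ⟫ ^ 2) / 4)) ≤
      Real.exp (-((1 / 32) * (dist θ (‖η‖⁻¹ • η) / ρ) ^ 2)) +
        Real.exp (-((1 / 32) * (dist θ (-(‖η‖⁻¹ • η)) / ρ) ^ 2)) := by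
  have hη : 0 < ‖η‖ := by
    rcases (norm_nonneg η).eq_or_lt with h0 | h0
    · rw [← h0] at h; norm_num at h
    · exact h0
  set e := ‖η‖⁻¹ • η with he
  have hen : ‖e‖ = 1 := by
    rw [he, norm_smul, norm_inv, norm_norm, inv_mul_cancel₀ hη.ne']
  have hce : ⟪η, θ⟫ = ‖η‖ * ⟪θ, e⟫ := by
    rw [he, inner_smul_right, real_inner_comm]
    field_simp
  set c := ⟪θ, e⟫ with hc
  have h1 : dist θ e ^ 2 = 2 - 2 * c := by
    rw [dist_eq_norm, norm_sub_sq_real, hθ, hen]; ring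
  have h2 : dist θ (-e) ^ 2 = 2 + 2 * c := by
    rw [dist_eq_norm, sub_neg_eq_add, norm_add_sq_real, hθ, hen]; ring
  have hcabs : |c| ≤ 1 := by
    have := abs_real_inner_le_norm θ e
    rwa [hθ, hen, one_mul] at this
  obtain ⟨hc1, hc2⟩ := abs_le.1 hcabs
  have h3 : 1 / ρ ^ 2 ≤ 4 * ‖η‖ ^ 2 := by
    rw [div_le_iff₀ (by positivity)]
    nlinarith
  have key : ∀ x, 0 ≤ x → x ≤ 2 * (1 - c ^ 2) →
      Real.exp (-((‖η‖ ^ 2 - ⟪η, θ⟫ ^ 2) / 4)) ≤ Real.exp (-((1 / 32) * (x / ρ ^ 2))) := by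
    intro x hx hxc
    apply Real.exp_le_exp.2
    rw [hce, div_eq_mul_one_div x]
    nlinarith [mul_le_mul_of_nonneg_left h3 hx, mul_le_mul_of_nonneg_right hxc (sq_nonneg ‖η‖)]
  rw [div_pow, div_pow, h1, h2]
  rcases le_total 0 c with h0 | h0
  · refine (key (2 - 2 * c) (by linarith) (by nlinarith)).trans ?_
    exact le_add_of_nonneg_right (Real.exp_nonneg _)
  · refine (key (2 + 2 * c) (by linarith) (by nlinarith)).trans ?_
    exact le_add_of_nonneg_left (Real.exp_nonneg _)

theorem exists_dyadic_scale (N : ℕ) (x : ℝ) :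
    ∃ k ≤ N, (k = 0 ∨ 1 / 2 ≤ (1 / 2) ^ k * x) ∧ (k = N ∨ (1 / 2) ^ k * x ≤ 1) := by
  induction N with
  | zero => exact ⟨0, le_rfl, Or.inl rfl, Or.inl rfl⟩
  | succ N ih =>
    obtain ⟨k, hk, h1, h2⟩ := ih
    by_cases h : (1 / 2) ^ k * x ≤ 1
    · exact ⟨k, hk.trans N.le_succ, h1, Or.inr h⟩
    · obtain rfl : k = N := h2.resolve_right h
      refine ⟨k + 1, le_rfl, Or.inr ?_, Or.inl rfl⟩
      rw [pow_succ]
      linarith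

/-- The mean over the directions `θ`, weighted by a `t`-dimensional Frostman weight `v`, of the
Gaussian neighbourhoods of the lines `ℝ θ` decays like `‖η‖ ^ (-t)`. -/
theorem exists_exp_mul_sum_exp_le {t : ℝ} (C : ℝ) (hC : 0 < C) :
    ∃ C' > 0, ∀ (F : Finset V) (v : V → ℝ) (N : ℕ), (∀ θ ∈ F, ‖θ‖ = 1) → (∀ θ, 0 ≤ v θ) →
      (∑ θ ∈ F, v θ ≤ C) →
      (∀ x r, (1 / 2 : ℝ) ^ N ≤ r → ∑ y ∈ F with dist y x ≤ r, v y ≤ C * r ^ t) → ∀ η : V,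
      Real.exp (-(((1 / 2 : ℝ) ^ N) ^ 2 * ‖η‖ ^ 2 / 2)) *
          ∑ θ ∈ F, v θ * Real.exp (-((‖η‖ ^ 2 - ⟪η, θ⟫ ^ 2) / 4)) ≤
        C' * ∑ k ∈ Finset.range (N + 1), ((1 / 2 : ℝ) ^ k) ^ t *
          Real.exp (-(1 / 2 * ((1 / 2 : ℝ) ^ k) ^ 2) * ‖η‖ ^ 2) := by
  obtain ⟨G, hG, hGauss⟩ := exists_sum_mul_exp_le t (show (0 : ℝ) < 1 / 32 by norm_num)
  refine ⟨Real.exp (1 / 2) * (C + 2 * (C * G)), by positivity, ?_⟩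
  intro F v N hF hv hmass hfro η
  obtain ⟨k, hkN, hk1, hk2⟩ := exists_dyadic_scale N ‖η‖
  set ρ : ℝ := (1 / 2) ^ k with hρ
  have hρ0 : 0 < ρ := by positivity
  have hNρ : (1 / 2 : ℝ) ^ N ≤ ρ := pow_le_pow_of_le_one (by norm_num) (by norm_num) hkN
  have hsum : ∑ θ ∈ F, v θ * Real.exp (-((‖η‖ ^ 2 - ⟪η, θ⟫ ^ 2) / 4)) ≤
      (C + 2 * (C * G)) * ρ ^ t := by
    rcases hk1 with rfl | hk1
    · have h1 : ∑ θ ∈ F, v θ * Real.exp (-((‖η‖ ^ 2 - ⟪η, θ⟫ ^ 2) / 4)) ≤ ∑ θ ∈ F, v θ := by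
        refine Finset.sum_le_sum fun θ hθ => mul_le_of_le_one_right (hv θ) ?_
        apply Real.exp_le_one_iff.2
        have := abs_real_inner_le_norm η θ
        rw [hF θ hθ, mul_one] at this
        have := sq_le_sq' (abs_le.1 this).1 (abs_le.1 this).2
        linarith
      rw [hρ, pow_zero, Real.one_rpow]
      have : 0 < C * G := by positivity
      linarith
    · have h1 := hGauss F v C _ hv (by positivity) hC.le hfro (‖η‖⁻¹ • η) ρ hNρ
      have h2 := hGauss F v C _ hv (by positivity) hC.le hfro (-(‖η‖⁻¹ • η)) ρ hNρ
      have h3 : ∑ θ ∈ F, v θ * Real.exp (-((‖η‖ ^ 2 - ⟪η, θ⟫ ^ 2) / 4)) ≤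
          ∑ θ ∈ F, v θ * Real.exp (-((1 / 32) * (dist θ (‖η‖⁻¹ • η) / ρ) ^ 2)) +
          ∑ θ ∈ F, v θ * Real.exp (-((1 / 32) * (dist θ (-(‖η‖⁻¹ • η)) / ρ) ^ 2)) := by
        rw [← Finset.sum_add_distrib]
        refine Finset.sum_le_sum fun θ hθ => ?_
        rw [← mul_add]
        exact mul_le_mul_of_nonneg_left (exp_neg_sq_norm_sub_sq_inner_le (hF θ hθ) hρ0 hk1) (hv θ)
      have : 0 < C * ρ ^ t := by positivity
      linarith
  have hexp : Real.exp (-(((1 / 2 : ℝ) ^ N) ^ 2 * ‖η‖ ^ 2 / 2)) ≤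
      Real.exp (1 / 2) * Real.exp (-(1 / 2 * ρ ^ 2) * ‖η‖ ^ 2) := by
    rw [← Real.exp_add]
    apply Real.exp_le_exp.2
    rcases hk2 with rfl | hk2
    · linarith
    · have h1 : (ρ * ‖η‖) ^ 2 ≤ 1 := pow_le_one₀ (by positivity) hk2
      have h2 : 0 ≤ ((1 / 2 : ℝ) ^ N) ^ 2 * ‖η‖ ^ 2 := by positivity
      nlinarith
  calc _ ≤ (Real.exp (1 / 2) * Real.exp (-(1 / 2 * ρ ^ 2) * ‖η‖ ^ 2)) *
        ((C + 2 * (C * G)) * ρ ^ t) := by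
        refine mul_le_mul hexp hsum (Finset.sum_nonneg fun θ _ => ?_) (by positivity)
        exact mul_nonneg (hv θ) (Real.exp_nonneg _)
    _ = Real.exp (1 / 2) * (C + 2 * (C * G)) *
          (ρ ^ t * Real.exp (-(1 / 2 * ρ ^ 2) * ‖η‖ ^ 2)) := by ring
    _ ≤ _ := by
        gcongr
        exact Finset.single_le_sum (f := fun k : ℕ => ((1 / 2 : ℝ) ^ k) ^ t *
          Real.exp (-(1 / 2 * ((1 / 2 : ℝ) ^ k) ^ 2) * ‖η‖ ^ 2)) (fun k _ => by positivity)
          (Finset.mem_range.2 (Nat.lt_succ_of_le hkN))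

variable [FiniteDimensional ℝ V] [MeasurableSpace V] [BorelSpace V]

theorem integrable_exp_mul_sq_norm_expSum (S : Finset ι) (w : ι → ℝ) (z : ι → V) {a : ℝ}
    (ha : 0 < a) : Integrable fun η : V => Real.exp (-a * ‖η‖ ^ 2) * ‖expSum S w z η‖ ^ 2 := by
  have h : Integrable fun η : V =>
      ((Real.exp (-a * ‖η‖ ^ 2) * ‖expSum S w z η‖ ^ 2 : ℝ) : ℂ) := by
    simp_rw [ofReal_exp_mul_sq_norm_expSum]
    refine integrable_finsetSum _ fun i _ => integrable_finsetSum _ fun j _ => ?_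
    exact (GaussianFourier.integrable_cexp_neg_mul_sq_norm_add (by simpa using ha) _ _).const_mul _
  exact h.re

theorem integral_exp_mul_sq_norm_expSum (S : Finset ι) (w : ι → ℝ) (z : ι → V) {a : ℝ}
    (ha : 0 < a) : ∫ η : V, Real.exp (-a * ‖η‖ ^ 2) * ‖expSum S w z η‖ ^ 2 =
      (Real.pi / a) ^ (Module.finrank ℝ V / 2 : ℝ) *
        ∑ i ∈ S, ∑ j ∈ S, w i * w j * Real.exp (-(‖z i - z j‖ ^ 2 / (4 * a))) := by
  have ha' : 0 < (a : ℂ).re := by simpa using ha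
  have hexpint : ∀ i j, Integrable fun η : V => ((w i * w j : ℝ) : ℂ) *
      Complex.exp (-a * ‖η‖ ^ 2 + Complex.I * (⟪z i - z j, η⟫ : ℝ)) := fun i j =>
    (GaussianFourier.integrable_cexp_neg_mul_sq_norm_add ha' _ _).const_mul _
  rw [← Complex.ofReal_inj, ← integral_complex_ofReal]
  simp_rw [ofReal_exp_mul_sq_norm_expSum]
  rw [integral_finsetSum _ fun i _ => integrable_finsetSum _ fun j _ => hexpint i j]
  simp_rw [integral_finsetSum S fun j _ => hexpint _ j, integral_const_mul,
    GaussianFourier.integral_cexp_neg_mul_sq_norm_add ha', Complex.I_sq]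
  push_cast
  rw [Complex.ofReal_cpow (by positivity), Finset.mul_sum]
  push_cast
  refine Finset.sum_congr rfl fun i _ => ?_
  rw [Finset.mul_sum]
  refine Finset.sum_congr rfl fun j _ => ?_
  rw [neg_one_mul, neg_div]
  ring

theorem lintegral_exp_mul_sq_norm_expSum (S : Finset ι) (w : ι → ℝ) (z : ι → V) {a : ℝ}
    (ha : 0 < a) :
    ∫⁻ η : V, ENNReal.ofReal (Real.exp (-a * ‖η‖ ^ 2) * ‖expSum S w z η‖ ^ 2) =
      ENNReal.ofReal ((Real.pi / a) ^ (Module.finrank ℝ V / 2 : ℝ) *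
        ∑ i ∈ S, ∑ j ∈ S, w i * w j * Real.exp (-(‖z i - z j‖ ^ 2 / (4 * a)))) := by
  rw [← integral_exp_mul_sq_norm_expSum S w z ha, ofReal_integral_eq_lintegral_ofReal
    (integrable_exp_mul_sq_norm_expSum S w z ha) (ae_of_all _ fun η => by positivity)]

/-- The uncertainty principle: since `z i` ranges over a bounded set, the Fourier transform of a
measure on the points `z i` is bounded by its average at unit scale, after a reweighting. -/
theorem sq_norm_expSum_le_lintegral (S : Finset ι) (w : ι → ℝ) (z : ι → V) (ξ : V) :
    ENNReal.ofReal (‖expSum S w z ξ‖ ^ 2) ≤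
      ENNReal.ofReal ((2 * Real.pi) ^ (Module.finrank ℝ V / 2 : ℝ))⁻¹ *
      ∫⁻ η : V, ENNReal.ofReal (Real.exp (-(1 / 2) * ‖η - ξ‖ ^ 2) *
        ‖expSum S (fun i => w i * Real.exp (‖z i‖ ^ 2 / 2)) z η‖ ^ 2) := by
  set w' : ι → ℝ := fun i => w i * Real.exp (‖z i‖ ^ 2 / 2) with hw'
  set c : ℝ := (2 * Real.pi) ^ (Module.finrank ℝ V / 2 : ℝ) with hc
  have hcpos : 0 < c := by positivity
  have hb : 0 < ((1 / 2 : ℝ) : ℂ).re := by norm_num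
  set g : V → ℝ := fun v => Real.exp (-(1 / 2) * ‖v‖ ^ 2) with hg
  have hgc : ∫ v : V, g v = c := by
    rw [GaussianFourier.integral_rexp_neg_mul_sq_norm (by norm_num : (0:ℝ) < 1 / 2), hc]
    congr 1
    ring
  have hgi : Integrable g := by
    by_contra h
    rw [integral_undef h] at hgc
    exact hcpos.ne hgc
  have hid : ∫ v : V, (g v : ℂ) * expSum S w' z (v + ξ) = c * expSum S w z ξ := by
    have h1 : ∀ v, (g v : ℂ) * expSum S w' z (v + ξ) =
        ∑ i ∈ S, ((w' i : ℂ) * Complex.exp (Complex.I * (⟪z i, ξ⟫ : ℝ))) *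
          Complex.exp (-((1 / 2 : ℝ) : ℂ) * ‖v‖ ^ 2 + Complex.I * (⟪z i, v⟫ : ℝ)) := by
      intro v
      rw [expSum, Finset.mul_sum]
      refine Finset.sum_congr rfl fun i _ => ?_
      rw [inner_add_right, Complex.ofReal_add, mul_add, Complex.exp_add, Complex.exp_add]
      simp only [hg]
      push_cast
      ring
    simp_rw [h1]
    rw [integral_finsetSum _ fun i _ =>
      (GaussianFourier.integrable_cexp_neg_mul_sq_norm_add hb _ _).const_mul _]
    simp_rw [integral_const_mul, GaussianFourier.integral_cexp_neg_mul_sq_norm_add hb]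
    rw [expSum, Finset.mul_sum]
    refine Finset.sum_congr rfl fun i _ => ?_
    have h2 : ((Real.pi : ℂ) / ((1 / 2 : ℝ) : ℂ)) ^ (Module.finrank ℝ V / 2 : ℂ) = (c : ℂ) := by
      rw [hc, Complex.ofReal_cpow (by positivity)]
      push_cast
      congr 1
      ring
    have h3 : (w' i : ℂ) * Complex.exp (Complex.I ^ 2 * ‖z i‖ ^ 2 / (4 * ((1 / 2 : ℝ) : ℂ))) =
        w i := by
      simp only [hw']
      push_cast
      rw [mul_assoc, ← Complex.exp_add, Complex.I_sq]
      ring_nf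
      simp
    rw [h2, ← h3]
    ring
  set h : V → ℝ := fun v => ‖expSum S w' z (v + ξ)‖ with hh
  have hhc : Continuous h := by
    have := continuous_expSum S w' z
    fun_prop
  obtain ⟨M, hM⟩ : ∃ M, ∀ v, h v ≤ M := by
    refine ⟨∑ i ∈ S, ‖(w' i : ℂ)‖, fun v => (norm_sum_le _ _).trans (Finset.sum_le_sum fun i _ => ?_)⟩
    rw [norm_mul, mul_comm Complex.I, Complex.norm_exp_ofReal_mul_I, mul_one]
  have hgh : Integrable fun v => g v * h v :=
    hgi.mul_bdd hhc.aestronglyMeasurable (ae_of_all _ fun v => by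
      rw [Real.norm_of_nonneg (norm_nonneg _)]; exact hM v)
  have hgh2 : Integrable fun v => g v * h v ^ 2 :=
    hgi.mul_bdd (c := M ^ 2) (hhc.pow 2).aestronglyMeasurable (ae_of_all _ fun v => by
      rw [Real.norm_of_nonneg (by positivity)]
      exact pow_le_pow_left₀ (norm_nonneg _) (hM v) 2)
  have hI : c * ‖expSum S w z ξ‖ ≤ ∫ v, g v * h v := by
    have h1 := norm_integral_le_integral_norm (μ := volume)
      fun v : V => (g v : ℂ) * expSum S w' z (v + ξ)
    rw [hid, norm_mul, Complex.norm_real, Real.norm_of_nonneg hcpos.le] at h1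
    refine h1.trans (le_of_eq (integral_congr_ae (ae_of_all _ fun v => ?_)))
    dsimp only
    rw [norm_mul, Complex.norm_real, Real.norm_of_nonneg (Real.exp_nonneg _)]
  have hCS : c * ‖expSum S w z ξ‖ ^ 2 ≤ ∫ v, g v * h v ^ 2 := by
    set m := ‖expSum S w z ξ‖
    have hm : 0 ≤ m := norm_nonneg _
    have h1 : ∫ v, 2 * m * (g v * h v) ≤ ∫ v, (g v * h v ^ 2 + m ^ 2 * g v) := by
      refine integral_mono (hgh.const_mul _) (hgh2.add (hgi.const_mul _)) fun v => ?_
      have : 0 ≤ g v * (h v - m) ^ 2 := mul_nonneg (Real.exp_nonneg _) (sq_nonneg _)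
      dsimp only
      nlinarith
    rw [integral_const_mul, integral_add hgh2 (hgi.const_mul _), integral_const_mul, hgc] at h1
    nlinarith [mul_le_mul_of_nonneg_left hI hm]
  have hshift : ∫⁻ η : V, ENNReal.ofReal (Real.exp (-(1 / 2) * ‖η - ξ‖ ^ 2) *
      ‖expSum S w' z η‖ ^ 2) = ENNReal.ofReal (∫ v, g v * h v ^ 2) := by
    rw [ofReal_integral_eq_lintegral_ofReal hgh2
      (ae_of_all _ fun v => mul_nonneg (Real.exp_nonneg _) (sq_nonneg _)),
      ← lintegral_add_right_eq_self _ ξ]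
    simp [hg, hh]
  rw [hshift, ← ENNReal.ofReal_mul (by positivity)]
  apply ENNReal.ofReal_le_ofReal
  rw [le_inv_mul_iff₀ hcpos]
  exact hCS

theorem ofReal_sum_exp_inner_le_lintegral (S : Finset V) (w : V → ℝ) {θ : V} (hθ : ‖θ‖ = 1) {δ : ℝ}
    (hδ : 0 < δ) (hδ2 : δ ≤ 1 / 2) :
    ENNReal.ofReal ((Real.pi / δ ^ 2) ^ (1 / 2 : ℝ) * ∑ x ∈ S, ∑ y ∈ S, w x * w y *
        Real.exp (-((⟪x, θ⟫ - ⟪y, θ⟫) ^ 2 / (4 * δ ^ 2)))) ≤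
      ENNReal.ofReal (((2 * Real.pi) ^ (Module.finrank ℝ V / 2 : ℝ))⁻¹ * √(Real.pi / (1 / 4))) *
      ∫⁻ η : V, ENNReal.ofReal ((Real.exp (-(δ ^ 2 * ‖η‖ ^ 2 / 2)) *
          Real.exp (-((‖η‖ ^ 2 - ⟪η, θ⟫ ^ 2) / 4))) *
        ‖expSum S (fun x => w x * Real.exp (‖x‖ ^ 2 / 2)) id η‖ ^ 2) := by
  set c : ℝ := ((2 * Real.pi) ^ (Module.finrank ℝ V / 2 : ℝ))⁻¹ with hc
  have hcpos : 0 < c := by positivity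
  set f : V → ℝ := fun η => ‖expSum S (fun x => w x * Real.exp (‖x‖ ^ 2 / 2)) id η‖ ^ 2 with hf
  have hfc : Continuous f := (continuous_expSum _ _ _).norm.pow 2
  have h1 := lintegral_exp_mul_sq_norm_expSum S w (fun x => ⟪x, θ⟫) (sq_pos_of_pos hδ)
  rw [Module.finrank_self, Nat.cast_one] at h1
  simp_rw [Real.norm_eq_abs (_ - _), sq_abs] at h1
  rw [← h1]
  calc _ ≤ ∫⁻ r : ℝ, ∫⁻ η : V, ENNReal.ofReal c * (ENNReal.ofReal (f η) * ENNReal.ofReal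
        (Real.exp (-δ ^ 2 * ‖r‖ ^ 2) * Real.exp (-(1 / 2) * ‖η - r • θ‖ ^ 2))) := by
        refine lintegral_mono fun r => ?_
        have h2 : ENNReal.ofReal (‖expSum S w id (r • θ)‖ ^ 2) ≤ ENNReal.ofReal c *
            ∫⁻ η : V, ENNReal.ofReal (Real.exp (-(1 / 2) * ‖η - r • θ‖ ^ 2) * f η) :=
          sq_norm_expSum_le_lintegral S w id (r • θ)
        rw [expSum_smul_eq_expSum_inner] at h2
        rw [ENNReal.ofReal_mul (Real.exp_nonneg _)]
        refine (mul_le_mul_right h2 _).trans (le_of_eq ?_)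
        rw [← lintegral_const_mul' _ _ ENNReal.ofReal_ne_top,
          ← lintegral_const_mul' _ _ ENNReal.ofReal_ne_top]
        refine lintegral_congr fun η => ?_
        rw [ENNReal.ofReal_mul (Real.exp_nonneg _), ENNReal.ofReal_mul (Real.exp_nonneg _)]
        ring
    _ = ∫⁻ η : V, ∫⁻ r : ℝ, ENNReal.ofReal c * (ENNReal.ofReal (f η) * ENNReal.ofReal
        (Real.exp (-δ ^ 2 * ‖r‖ ^ 2) * Real.exp (-(1 / 2) * ‖η - r • θ‖ ^ 2))) := by
        refine lintegral_lintegral_swap (Measurable.aemeasurable ?_)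
        unfold Function.uncurry
        fun_prop
    _ ≤ ∫⁻ η : V, ENNReal.ofReal c * (ENNReal.ofReal (f η) *
        ENNReal.ofReal (√(Real.pi / (1 / 4)) * (Real.exp (-(δ ^ 2 * ‖η‖ ^ 2 / 2)) *
          Real.exp (-((‖η‖ ^ 2 - ⟪η, θ⟫ ^ 2) / 4))))) := by
        refine lintegral_mono fun η => ?_
        dsimp only
        rw [lintegral_const_mul _ (by fun_prop), lintegral_const_mul _ (by fun_prop)]
        gcongr
        exact lintegral_exp_mul_exp_le hθ hδ hδ2 η
    _ = _ := by
        rw [← lintegral_const_mul' _ _ ENNReal.ofReal_ne_top]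
        refine lintegral_congr fun η => ?_
        rw [← ENNReal.ofReal_mul (by positivity), ← ENNReal.ofReal_mul (by positivity),
          ← ENNReal.ofReal_mul (by positivity)]
        congr 1
        ring

/-- The averaged `L²` estimate for the projections of a discrete `s`-dimensional weight onto a
discrete `t`-dimensional set of lines, where `s + t` exceeds the dimension of the space. -/
theorem exists_sum_sum_sum_exp_inner_le {s t C M : ℝ} (hC : 0 < C)
    (hst : (Module.finrank ℝ V : ℝ) < s + t) :
    ∃ C' > 0, ∀ (S F : Finset V) (w v : V → ℝ) (N : ℕ), 1 ≤ N → (∀ x ∈ S, ‖x‖ ≤ M) →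
      (∀ θ ∈ F, ‖θ‖ = 1) → (∀ x, 0 ≤ w x) → (∀ θ, 0 ≤ v θ) →
      (∑ x ∈ S, w x ≤ C) → (∑ θ ∈ F, v θ ≤ C) →
      (∀ x r, (1 / 2 : ℝ) ^ N ≤ r → ∑ y ∈ S with dist y x ≤ r, w y ≤ C * r ^ s) →
      (∀ x r, (1 / 2 : ℝ) ^ N ≤ r → ∑ y ∈ F with dist y x ≤ r, v y ≤ C * r ^ t) →
      ∑ θ ∈ F, v θ * ∑ x ∈ S, ∑ y ∈ S, w x * w y *
        Real.exp (-((⟪x, θ⟫ - ⟪y, θ⟫) ^ 2 / (4 * ((1 / 2 : ℝ) ^ N) ^ 2))) ≤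
          C' * (1 / 2 : ℝ) ^ N := by
  set d : ℝ := (Module.finrank ℝ V : ℝ) with hd
  obtain ⟨G, hG, hGauss⟩ := exists_sum_mul_exp_le s (show (0 : ℝ) < 1 / 2 by norm_num)
  obtain ⟨D, hD, hdir⟩ := exists_exp_mul_sum_exp_le (V := V) (t := t) C hC
  set c : ℝ := ((2 * Real.pi) ^ (d / 2 : ℝ))⁻¹ * √(Real.pi / (1 / 4)) with hc
  have hcpos : 0 < c := by positivity
  set q : ℝ := (1 / 2 : ℝ) ^ (s + t - d) with hq
  have hq0 : 0 < q := by positivity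
  have hq1 : q < 1 := Real.rpow_lt_one (by norm_num) (by norm_num) (by linarith)
  set E : ℝ := (2 * Real.pi) ^ (d / 2) * (Real.exp (M ^ 2) * (C * (C * G))) with hE
  have hE0 : 0 < E := by positivity
  refine ⟨(Real.pi ^ (1 / 2 : ℝ))⁻¹ * (c * (D * E * (1 - q)⁻¹)), ?_, ?_⟩
  · have : 0 < 1 - q := by linarith
    positivity
  intro S F w v N hN hSM hF hw hv hwC hvC hwfro hvfro
  set δ : ℝ := (1 / 2) ^ N with hδ
  have hδ0 : 0 < δ := by positivity
  have hδ2 : δ ≤ 1 / 2 := by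
    exact (pow_le_pow_of_le_one (by norm_num) (by norm_num) hN).trans_eq (pow_one _)
  set f : V → ℝ := fun η => ‖expSum S (fun x => w x * Real.exp (‖x‖ ^ 2 / 2)) id η‖ ^ 2 with hf
  have hfc : Continuous f := (continuous_expSum _ _ _).norm.pow 2
  have hf0 : ∀ η, 0 ≤ f η := fun η => by positivity
  set J : V → ℝ := fun θ => ∑ x ∈ S, ∑ y ∈ S, w x * w y *
    Real.exp (-((⟪x, θ⟫ - ⟪y, θ⟫) ^ 2 / (4 * δ ^ 2))) with hJ
  have hJ0 : ∀ θ, 0 ≤ J θ := fun θ => Finset.sum_nonneg fun x _ => Finset.sum_nonneg fun y _ =>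
    mul_nonneg (mul_nonneg (hw x) (hw y)) (Real.exp_nonneg _)
  have hscale : ∀ k ∈ Finset.range (N + 1), ((1 / 2 : ℝ) ^ k) ^ t *
      ((Real.pi / (1 / 2 * ((1 / 2 : ℝ) ^ k) ^ 2)) ^ (d / 2) * ∑ x ∈ S, ∑ y ∈ S,
        (w x * Real.exp (‖x‖ ^ 2 / 2)) * (w y * Real.exp (‖y‖ ^ 2 / 2)) *
          Real.exp (-(‖x - y‖ ^ 2 / (4 * (1 / 2 * ((1 / 2 : ℝ) ^ k) ^ 2))))) ≤ E * q ^ k := by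
    intro k hk
    set ρ : ℝ := (1 / 2) ^ k with hρ
    have hρ0 : 0 < ρ := by positivity
    have hNρ : δ ≤ ρ := pow_le_pow_of_le_one (by norm_num) (by norm_num)
      (Nat.lt_succ_iff.1 (Finset.mem_range.1 hk))
    have h1 : ∑ x ∈ S, ∑ y ∈ S, (w x * Real.exp (‖x‖ ^ 2 / 2)) * (w y * Real.exp (‖y‖ ^ 2 / 2)) *
        Real.exp (-(‖x - y‖ ^ 2 / (4 * (1 / 2 * ρ ^ 2)))) ≤
        Real.exp (M ^ 2) * (C * (C * G * ρ ^ s)) := by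
      calc _ ≤ ∑ x ∈ S, Real.exp (M ^ 2) * (w x *
            ∑ y ∈ S, w y * Real.exp (-(1 / 2 * (dist y x / ρ) ^ 2))) := by
            refine Finset.sum_le_sum fun x hx => ?_
            rw [Finset.mul_sum, Finset.mul_sum]
            refine Finset.sum_le_sum fun y hy => ?_
            have h2 : Real.exp (‖x‖ ^ 2 / 2) * Real.exp (‖y‖ ^ 2 / 2) ≤ Real.exp (M ^ 2) := by
              rw [← Real.exp_add]
              apply Real.exp_le_exp.2
              have := pow_le_pow_left₀ (norm_nonneg x) (hSM x hx) 2
              have := pow_le_pow_left₀ (norm_nonneg y) (hSM y hy) 2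
              linarith
            have h3 : ‖x - y‖ ^ 2 / (4 * (1 / 2 * ρ ^ 2)) = 1 / 2 * (dist y x / ρ) ^ 2 := by
              rw [dist_comm, dist_eq_norm]
              field_simp
              norm_num
            rw [h3]
            have := hw x
            have := hw y
            calc _ = (Real.exp (‖x‖ ^ 2 / 2) * Real.exp (‖y‖ ^ 2 / 2)) *
                  (w x * (w y * Real.exp (-(1 / 2 * (dist y x / ρ) ^ 2)))) := by ring
              _ ≤ _ := by gcongr
        _ ≤ ∑ x ∈ S, Real.exp (M ^ 2) * (w x * (C * G * ρ ^ s)) := by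
            refine Finset.sum_le_sum fun x hx => ?_
            have := hw x
            have := hGauss S w C δ hw hδ0 hC.le hwfro x ρ hNρ
            gcongr
        _ = Real.exp (M ^ 2) * ((∑ x ∈ S, w x) * (C * G * ρ ^ s)) := by
            rw [← Finset.mul_sum, Finset.sum_mul]
        _ ≤ _ := by gcongr
    have h2 : (Real.pi / (1 / 2 * ρ ^ 2)) ^ (d / 2) = (2 * Real.pi) ^ (d / 2) * ρ ^ (-d) := by
      have : Real.pi / (1 / 2 * ρ ^ 2) = (2 * Real.pi) * ρ ^ (-2 : ℝ) := by
        rw [Real.rpow_neg hρ0.le, Real.rpow_two]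
        field_simp
      rw [this, Real.mul_rpow (by positivity) (by positivity), ← Real.rpow_mul hρ0.le]
      congr 2
      ring
    have h3 : ρ ^ t * ρ ^ (-d) * ρ ^ s = q ^ k := by
      rw [← Real.rpow_add hρ0, ← Real.rpow_add hρ0, hρ, hq, ← Real.rpow_natCast,
        ← Real.rpow_mul (by norm_num), ← Real.rpow_natCast, ← Real.rpow_mul (by norm_num)]
      congr 1
      ring
    rw [h2]
    calc _ ≤ ρ ^ t * (((2 * Real.pi) ^ (d / 2) * ρ ^ (-d)) *
          (Real.exp (M ^ 2) * (C * (C * G * ρ ^ s)))) := by gcongr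
      _ = E * (ρ ^ t * ρ ^ (-d) * ρ ^ s) := by rw [hE]; ring
      _ = _ := by rw [h3]
  have hgeom : ∑ k ∈ Finset.range (N + 1), q ^ k ≤ (1 - q)⁻¹ := by
    rw [← tsum_geometric_of_lt_one hq0.le hq1]
    exact (summable_geometric_of_lt_one hq0.le hq1).sum_le_tsum _ fun k _ => by positivity
  have hmain : ENNReal.ofReal ((Real.pi / δ ^ 2) ^ (1 / 2 : ℝ) * ∑ θ ∈ F, v θ * J θ) ≤
      ENNReal.ofReal (c * (D * E * (1 - q)⁻¹)) := by
    calc _ = ∑ θ ∈ F, ENNReal.ofReal (v θ) *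
          ENNReal.ofReal ((Real.pi / δ ^ 2) ^ (1 / 2 : ℝ) * J θ) := by
          rw [Finset.mul_sum, ENNReal.ofReal_sum_of_nonneg fun θ _ =>
            mul_nonneg (by positivity) (mul_nonneg (hv θ) (hJ0 θ))]
          refine Finset.sum_congr rfl fun θ _ => ?_
          rw [← ENNReal.ofReal_mul (hv θ)]
          congr 1
          ring
      _ ≤ ∑ θ ∈ F, ENNReal.ofReal (v θ) * (ENNReal.ofReal c * ∫⁻ η : V, ENNReal.ofReal
          ((Real.exp (-(δ ^ 2 * ‖η‖ ^ 2 / 2)) * Real.exp (-((‖η‖ ^ 2 - ⟪η, θ⟫ ^ 2) / 4))) *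
            f η)) := by
          refine Finset.sum_le_sum fun θ hθ => mul_le_mul_right ?_ _
          exact ofReal_sum_exp_inner_le_lintegral S w (hF θ hθ) hδ0 hδ2
      _ = ENNReal.ofReal c * ∫⁻ η : V, ENNReal.ofReal ((Real.exp (-(δ ^ 2 * ‖η‖ ^ 2 / 2)) *
            ∑ θ ∈ F, v θ * Real.exp (-((‖η‖ ^ 2 - ⟪η, θ⟫ ^ 2) / 4))) * f η) := by
          simp_rw [mul_left_comm _ (ENNReal.ofReal c)]
          rw [← Finset.mul_sum]
          congr 1
          simp_rw [← lintegral_const_mul' _ _ ENNReal.ofReal_ne_top]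
          rw [← lintegral_finsetSum _ fun θ _ => by fun_prop]
          refine lintegral_congr fun η => ?_
          rw [Finset.mul_sum, Finset.sum_mul, ENNReal.ofReal_sum_of_nonneg fun θ _ => by
            have := hv θ
            have := hf0 η
            positivity]
          refine Finset.sum_congr rfl fun θ _ => ?_
          rw [← ENNReal.ofReal_mul (hv θ)]
          congr 1
          ring
      _ ≤ ENNReal.ofReal c * ∫⁻ η : V, ENNReal.ofReal ((D * ∑ k ∈ Finset.range (N + 1),
            ((1 / 2 : ℝ) ^ k) ^ t * Real.exp (-(1 / 2 * ((1 / 2 : ℝ) ^ k) ^ 2) * ‖η‖ ^ 2)) *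
              f η) := by
          refine mul_le_mul_right (lintegral_mono fun η => ENNReal.ofReal_le_ofReal ?_) _
          exact mul_le_mul_of_nonneg_right (hdir F v N hF hv hvC hvfro η) (hf0 η)
      _ = ENNReal.ofReal c * ∑ k ∈ Finset.range (N + 1), ENNReal.ofReal (D * ((1 / 2 : ℝ) ^ k) ^ t) *
            ∫⁻ η : V, ENNReal.ofReal
              (Real.exp (-(1 / 2 * ((1 / 2 : ℝ) ^ k) ^ 2) * ‖η‖ ^ 2) * f η) := by
          congr 1
          simp_rw [← lintegral_const_mul' _ _ ENNReal.ofReal_ne_top]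
          rw [← lintegral_finsetSum _ fun k _ => by fun_prop]
          refine lintegral_congr fun η => ?_
          rw [Finset.mul_sum, Finset.sum_mul, ENNReal.ofReal_sum_of_nonneg fun k _ => by
            have := hf0 η
            positivity]
          refine Finset.sum_congr rfl fun k _ => ?_
          rw [← ENNReal.ofReal_mul (by positivity)]
          congr 1
          ring
      _ ≤ ENNReal.ofReal c * ∑ k ∈ Finset.range (N + 1), ENNReal.ofReal (D * (E * q ^ k)) := by
          refine mul_le_mul_right (Finset.sum_le_sum fun k hk => ?_) _
          rw [lintegral_exp_mul_sq_norm_expSum S _ id (by positivity),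
            ← ENNReal.ofReal_mul (by positivity)]
          apply ENNReal.ofReal_le_ofReal
          rw [mul_assoc]
          exact mul_le_mul_of_nonneg_left (hscale k hk) hD.le
      _ ≤ _ := by
          rw [← ENNReal.ofReal_sum_of_nonneg fun k _ => by positivity,
            ← ENNReal.ofReal_mul hcpos.le]
          apply ENNReal.ofReal_le_ofReal
          rw [← Finset.mul_sum, ← Finset.mul_sum, mul_assoc D E]
          gcongr
  have h1 : 0 ≤ c * (D * E * (1 - q)⁻¹) := by
    have : 0 < 1 - q := by linarith
    positivity
  rw [ENNReal.ofReal_le_ofReal_iff h1, Real.div_rpow Real.pi_pos.le (by positivity),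
    ← Real.sqrt_eq_rpow (δ ^ 2), Real.sqrt_sq hδ0.le, div_mul_eq_mul_div, div_le_iff₀ hδ0] at hmain
  rw [mul_assoc, le_inv_mul_iff₀ (by positivity)]
  exact hmain

end Fourier

/-- If the near-diagonal energy of a weight on points of the line is small at scale `δ`, then the
`δ`-neighbourhood of these points is large. -/
theorem le_volume_of_sum_exp_le {ι : Type*} (S : Finset ι) (w u : ι → ℝ) (hw : ∀ i, 0 ≤ w i)
    {δ c C : ℝ} (hδ : 0 < δ) (hc : 0 < c) (hC : 0 < C) (hcw : c ≤ ∑ i ∈ S, w i)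
    (hJ : ∑ i ∈ S, ∑ j ∈ S, w i * w j * Real.exp (-((u i - u j) ^ 2 / (4 * δ ^ 2))) ≤ C * δ)
    {T : Set ℝ} (hT : MeasurableSet T) (hST : ∀ i ∈ S, closedBall (u i) δ ⊆ T) :
    ENNReal.ofReal (2 * c ^ 2 / (Real.exp 1 * C)) ≤ volume T := by
  classical
  rcases eq_or_ne (volume T) ∞ with htop | htop
  · rw [htop]; exact le_top
  rw [ENNReal.ofReal_le_iff_le_toReal htop]
  set e := Real.exp 1 with he
  have he0 : 0 < e := Real.exp_pos 1
  set b : ι → ℝ → ℝ := fun i => (closedBall (u i) δ).indicator 1 with hb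
  have hbval : ∀ i x, b i x = if x ∈ closedBall (u i) δ then 1 else 0 := fun i x => by
    simp [hb, Set.indicator_apply]
  have hbint : ∀ i, Integrable (b i) := fun i =>
    (integrable_indicator_iff measurableSet_closedBall).2
      (integrableOn_const measure_closedBall_lt_top.ne)
  have hbI : ∀ i, ∫ x, b i x = 2 * δ := fun i => by
    rw [hb, integral_indicator_one measurableSet_closedBall, Measure.real, Real.volume_closedBall,
      ENNReal.toReal_ofReal (by positivity)]
  have hTint : Integrable (T.indicator (1 : ℝ → ℝ)) :=
    (integrable_indicator_iff hT).2 (integrableOn_const htop)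
  set l : ℝ := c / (e * C * δ) with hl
  have hl0 : 0 < l := by positivity
  set k : ι → ι → ℝ := fun i j => e * Real.exp (-((u i - u j) ^ 2 / (4 * δ ^ 2))) with hk
  have hbb : ∀ i j x, b i x * b j x ≤ k i j * b i x := by
    intro i j x
    simp only [hbval]
    by_cases hi : x ∈ closedBall (u i) δ
    · by_cases hj : x ∈ closedBall (u j) δ
      · simp only [hi, hj, if_true, mul_one]
        change 1 ≤ Real.exp 1 * Real.exp _
        rw [← Real.exp_add]
        apply Real.one_le_exp
        have h1 : |u i - u j| ≤ 2 * δ := by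
          rw [← Real.dist_eq]
          have := dist_triangle_left (u i) (u j) x
          rw [mem_closedBall] at hi hj
          linarith
        have h2 : (u i - u j) ^ 2 ≤ (2 * δ) ^ 2 := sq_le_sq' (abs_le.1 h1).1 (abs_le.1 h1).2
        have : (u i - u j) ^ 2 / (4 * δ ^ 2) ≤ 1 := by
          rw [div_le_one (by positivity)]
          linarith
        linarith
      · simp only [hi, hj, if_true, if_false, mul_zero, mul_one]
        positivity
    · simp [hi]
  have hpt : ∀ x, 2 * ∑ i ∈ S, w i * b i x ≤
      l * ∑ i ∈ S, ∑ j ∈ S, (w i * w j * k i j) * b i x + l⁻¹ * T.indicator 1 x := by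
    intro x
    have h1 : (∑ i ∈ S, w i * b i x) ^ 2 ≤ ∑ i ∈ S, ∑ j ∈ S, (w i * w j * k i j) * b i x := by
      rw [sq, Finset.sum_mul_sum]
      refine Finset.sum_le_sum fun i _ => Finset.sum_le_sum fun j _ => ?_
      have := mul_le_mul_of_nonneg_left (hbb i j x) (mul_nonneg (hw i) (hw j))
      linarith
    by_cases hx : x ∈ T
    · rw [indicator_of_mem hx, Pi.one_apply, mul_one]
      set f := ∑ i ∈ S, w i * b i x
      have h2 : 2 * f ≤ l * f ^ 2 + l⁻¹ := by
        have h3 : 0 ≤ l * (f - l⁻¹) ^ 2 := by positivity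
        have h4 : l * (f - l⁻¹) ^ 2 = l * f ^ 2 - 2 * f + l⁻¹ := by
          field_simp
          ring
        linarith
      have := mul_le_mul_of_nonneg_left h1 hl0.le
      linarith
    · have h2 : ∀ i ∈ S, b i x = 0 := fun i hi => by
        rw [hbval, if_neg fun h => hx (hST i hi h)]
      have h3 : ∑ i ∈ S, w i * b i x = 0 := Finset.sum_eq_zero fun i hi => by rw [h2 i hi, mul_zero]
      rw [h3] at h1 ⊢
      rw [indicator_of_notMem hx]
      have := mul_le_mul_of_nonneg_left h1 hl0.le
      linarith
  have hfi : Integrable fun x => ∑ i ∈ S, w i * b i x :=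
    integrable_finsetSum _ fun i _ => (hbint i).const_mul _
  have hgi : Integrable fun x => ∑ i ∈ S, ∑ j ∈ S, (w i * w j * k i j) * b i x :=
    integrable_finsetSum _ fun i _ => integrable_finsetSum _ fun j _ => (hbint i).const_mul _
  have hexpint := integral_mono (hfi.const_mul 2) ((hgi.const_mul l).add (hTint.const_mul l⁻¹)) hpt
  simp only [Pi.add_apply] at hexpint
  rw [integral_add (hgi.const_mul l) (hTint.const_mul l⁻¹), integral_const_mul, integral_const_mul,
    integral_const_mul, integral_indicator_one hT,
    integral_finsetSum _ fun i _ => (hbint i).const_mul _,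
    integral_finsetSum _ fun i _ => integrable_finsetSum _ fun j _ => (hbint i).const_mul _] at hexpint
  simp_rw [integral_finsetSum S fun j _ => (hbint _).const_mul _, integral_const_mul, hbI,
    ← Finset.sum_mul] at hexpint
  have hk' : ∑ i ∈ S, ∑ j ∈ S, w i * w j * k i j ≤ e * (C * δ) := by
    refine le_trans (le_of_eq ?_) (mul_le_mul_of_nonneg_left hJ he0.le)
    simp_rw [Finset.mul_sum, hk]
    exact Finset.sum_congr rfl fun i _ => Finset.sum_congr rfl fun j _ => by ring
  have h1 : 2 * (c * (2 * δ)) ≤ l * (e * (C * δ) * (2 * δ)) + l⁻¹ * volume.real T := by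
    calc _ ≤ 2 * ((∑ i ∈ S, w i) * (2 * δ)) := by gcongr
      _ ≤ _ := hexpint
      _ ≤ _ := by gcongr
  have h2 : l * (e * (C * δ) * (2 * δ)) = 2 * c * δ := by
    rw [hl]; field_simp
  have h3 : l⁻¹ = e * C * δ / c := by rw [hl, inv_div]
  rw [h2, h3] at h1
  change _ ≤ volume.real T
  rw [div_le_iff₀ (by positivity)]
  have h4 : 2 * c * δ ≤ e * C * δ / c * volume.real T := by linarith
  rw [div_mul_eq_mul_div, le_div_iff₀ hc] at h4
  have h5 : δ * (2 * c ^ 2) ≤ δ * (volume.real T * (e * C)) := by linarith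
  exact le_of_mul_le_mul_left h5 hδ

/-- If every point of a sequence of projections of `E` has large neighbourhoods at scales tending to
`0`, then so has a limit projection. -/
theorem exists_pos_volume_inner_image_of_le_cthickening {V : Type*} [NormedAddCommGroup V]
    [InnerProductSpace ℝ V] {E F : Set V} (hE : IsCompact E) (hF : IsCompact F) {κ : ℝ≥0∞}
    (hκ : 0 < κ) (δ : ℕ → ℝ) (hδ : Tendsto δ atTop (𝓝 0)) (θ : ℕ → V) (hθ : ∀ N, θ N ∈ F)
    (h : ∀ N, κ ≤ volume (cthickening (δ N) ((fun x => ⟪x, θ N⟫) '' E))) :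
    ∃ θ ∈ F, 0 < volume ((fun x => ⟪x, θ⟫) '' E) := by
  obtain ⟨θ₀, hθ₀, φ, hφ, hlim⟩ := hF.tendsto_subseq hθ
  refine ⟨θ₀, hθ₀, hκ.trans_le ?_⟩
  obtain ⟨M, hM⟩ := hE.isBounded.exists_norm_le
  have hK : IsCompact ((fun x => ⟪x, θ₀⟫) '' E) := hE.image (by fun_prop)
  have hle : ∀ ε > 0, κ ≤ volume (cthickening ε ((fun x => ⟪x, θ₀⟫) '' E)) := by
    intro ε hε
    have h1 : ∀ᶠ N in atTop, δ (φ N) < ε / 2 :=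
      (hδ.comp hφ.tendsto_atTop).eventually (gt_mem_nhds (by positivity))
    have h2 : ∀ᶠ N in atTop, M * dist (θ (φ N)) θ₀ < ε / 2 := by
      have : Tendsto (fun N => M * dist (θ (φ N)) θ₀) atTop (𝓝 (M * 0)) :=
        (tendsto_iff_dist_tendsto_zero.1 hlim).const_mul M
      rw [mul_zero] at this
      exact this.eventually (gt_mem_nhds (by positivity))
    obtain ⟨N, h1, h2⟩ := (h1.and h2).exists
    refine (h (φ N)).trans (measure_mono ?_)
    have h3 : (fun x => ⟪x, θ (φ N)⟫) '' E ⊆ cthickening (ε / 2) ((fun x => ⟪x, θ₀⟫) '' E) := by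
      rintro _ ⟨x, hx, rfl⟩
      refine mem_cthickening_of_dist_le _ _ _ _ (mem_image_of_mem _ hx) ?_
      rw [Real.dist_eq, ← inner_sub_right]
      calc _ ≤ ‖x‖ * ‖θ (φ N) - θ₀‖ := abs_real_inner_le_norm _ _
        _ ≤ M * dist (θ (φ N)) θ₀ := by
            rw [dist_eq_norm]
            gcongr
            exact hM x hx
        _ ≤ _ := h2.le
    calc cthickening (δ (φ N)) ((fun x => ⟪x, θ (φ N)⟫) '' E)
        ⊆ cthickening (ε / 2) (cthickening (ε / 2) ((fun x => ⟪x, θ₀⟫) '' E)) :=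
          (cthickening_mono h1.le _).trans (cthickening_subset_of_subset _ h3)
      _ ⊆ cthickening (ε / 2 + ε / 2) ((fun x => ⟪x, θ₀⟫) '' E) :=
          cthickening_cthickening_subset (by positivity) (by positivity) _
      _ = _ := by rw [add_halves]
  have ht : Tendsto (fun r => volume (cthickening r ((fun x => ⟪x, θ₀⟫) '' E))) (𝓝[>] 0)
      (𝓝 (volume ((fun x => ⟪x, θ₀⟫) '' E))) :=
    (tendsto_measure_cthickening_of_isCompact hK).mono_left nhdsWithin_le_nhds
  exact ge_of_tendsto ht (by filter_upwards [self_mem_nhdsWithin] with ε hε using hle ε hε)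

/-- Falconer's theorem on exceptional projections to lines: an `s`-dimensional compact set projects
to a set of positive length in some direction of any `t`-dimensional compact set of directions, as
soon as `s + t` exceeds the dimension of the space. -/
theorem exists_pos_volume_inner_image {V : Type*} [NormedAddCommGroup V] [InnerProductSpace ℝ V]
    [FiniteDimensional ℝ V] [MeasurableSpace V] [BorelSpace V] {E F : Set V} (hE : IsCompact E)
    (hF : IsCompact F) (hF1 : ∀ θ ∈ F, ‖θ‖ = 1) {s t : ℝ} (hs : 0 < s) (ht : 0 < t)
    (hst : (Module.finrank ℝ V : ℝ) < s + t) (hEs : μH[s] E ≠ 0) (hFt : μH[t] F ≠ 0) :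
    ∃ θ ∈ F, 0 < volume ((fun x => ⟪x, θ⟫) '' E) := by
  obtain ⟨c₁, hc₁, hfroE⟩ := exists_finset_weight_of_hausdorffMeasure_ne_zero hE hs hEs
  obtain ⟨c₂, hc₂, hfroF⟩ := exists_finset_weight_of_hausdorffMeasure_ne_zero hF ht hFt
  obtain ⟨M₀, hM₀⟩ := hE.isBounded.exists_norm_le
  set M := max M₀ 1
  have hM1 : 1 ≤ M := le_max_right _ _
  have hM : ∀ x ∈ E, ‖x‖ ≤ M := fun x hx => (hM₀ x hx).trans (le_max_left _ _)
  set C : ℝ := 2 ^ s * M ^ s + 2 ^ t with hC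
  have hMs : 1 ≤ M ^ s := Real.one_le_rpow hM1 hs.le
  have h2s : (0 : ℝ) < 2 ^ s := by positivity
  have h2t : (0 : ℝ) < 2 ^ t := by positivity
  have hC0 : 0 < C := by positivity
  have hsC : 2 ^ s ≤ C := by nlinarith
  have htC : 2 ^ t ≤ C := by
    have : 0 ≤ 2 ^ s * M ^ s := by positivity
    linarith
  obtain ⟨C', hC', henergy⟩ := exists_sum_sum_sum_exp_inner_le (V := V) (M := M) hC0 hst
  set κ := 2 * c₁ ^ 2 / (Real.exp 1 * (2 * C' / c₂)) with hκ
  have hκ0 : 0 < κ := by positivity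
  have key : ∀ N : ℕ, ∃ θ ∈ F, ENNReal.ofReal κ ≤
      volume (cthickening ((1 / 2 : ℝ) ^ (N + 1)) ((fun x => ⟪x, θ⟫) '' E)) := by
    intro N
    set δ : ℝ := (1 / 2) ^ (N + 1) with hδ
    have hδ0 : 0 < δ := by positivity
    have hδ1 : δ ≤ 1 := pow_le_one₀ (by norm_num) (by norm_num)
    obtain ⟨S, w, hSE, hw, hcw, hwf⟩ := hfroE δ hδ0
    obtain ⟨D, v, hDF, hv, hcv, hvf⟩ := hfroF δ hδ0
    have hwC : ∑ x ∈ S, w x ≤ C := by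
      have h1 := hwf 0 M (hδ1.trans hM1)
      rw [Finset.filter_true_of_mem fun x hx => by
        rw [dist_zero_right]; exact hM x (hSE hx)] at h1
      linarith
    have hvC : ∑ x ∈ D, v x ≤ C := by
      have h1 := hvf 0 1 hδ1
      rw [Finset.filter_true_of_mem fun x hx => by
        rw [dist_zero_right]; exact (hF1 x (hDF hx)).le, Real.one_rpow] at h1
      linarith
    have hen := henergy S D w v (N + 1) (Nat.succ_le_succ N.zero_le) (fun x hx => hM x (hSE hx))
      (fun x hx => hF1 x (hDF hx)) hw hv hwC hvC
      (fun x r hr => (hwf x r hr).trans (mul_le_mul_of_nonneg_right hsC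
        (Real.rpow_nonneg (hδ0.le.trans hr) _)))
      (fun x r hr => (hvf x r hr).trans (mul_le_mul_of_nonneg_right htC
        (Real.rpow_nonneg (hδ0.le.trans hr) _)))
    obtain ⟨θ, hθD, hθ⟩ : ∃ θ ∈ D, ∑ x ∈ S, ∑ y ∈ S, w x * w y *
        Real.exp (-((⟪x, θ⟫ - ⟪y, θ⟫) ^ 2 / (4 * δ ^ 2))) ≤ 2 * C' / c₂ * δ := by
      by_contra! hcon
      have h1 : (∑ θ ∈ D, v θ) * (2 * C' / c₂ * δ) ≤ C' * δ := by
        rw [Finset.sum_mul]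
        refine le_trans (Finset.sum_le_sum fun θ hθ => ?_) hen
        exact mul_le_mul_of_nonneg_left (hcon θ hθ).le (hv θ)
      have h2 : c₂ * (2 * C' / c₂ * δ) ≤ (∑ θ ∈ D, v θ) * (2 * C' / c₂ * δ) := by gcongr
      have h3 : c₂ * (2 * C' / c₂ * δ) = 2 * (C' * δ) := by field_simp
      have : 0 < C' * δ := by positivity
      linarith
    refine ⟨θ, hDF hθD, le_volume_of_sum_exp_le S w (fun x => ⟪x, θ⟫) hw hδ0 hc₁ (by positivity) hcw
      hθ (isClosed_cthickening (E := (fun x => ⟪x, θ⟫) '' E)).measurableSet fun x hx => ?_⟩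
    exact closedBall_subset_cthickening (mem_image_of_mem (fun x => ⟪x, θ⟫) (hSE hx)) δ
  choose θ hθF hθ using key
  refine exists_pos_volume_inner_image_of_le_cthickening hE hF (ENNReal.ofReal_pos.2 hκ0)
    (fun N => (1 / 2 : ℝ) ^ (N + 1)) ?_ θ hθF hθ
  exact (tendsto_pow_atTop_nhds_zero_of_lt_one (by norm_num) (by norm_num)).comp
    (tendsto_add_atTop_nat 1)

/-- A map with injective strict derivative locally does not decrease Hausdorff dimension. -/
theorem exists_isCompact_subset_lt_dimH_image {X Y : Type*} [NormedAddCommGroup X]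
    [NormedSpace ℝ X] [FiniteDimensional ℝ X] [NormedAddCommGroup Y] [NormedSpace ℝ Y] {f : X → Y}
    {A : Set X} (hA : IsCompact A) (hf : ∀ x ∈ A, ContDiffAt ℝ 1 f x)
    (hinj : ∀ x ∈ A, Function.Injective (fderiv ℝ f x)) {r : ℝ≥0∞} (hr : r < dimH A) :
    ∃ A' ⊆ A, IsCompact A' ∧ r < dimH (f '' A') := by
  obtain ⟨x, hxA, hx⟩ := exists_mem_nhdsWithin_lt_dimH_of_lt_dimH hr
  obtain ⟨K, hK0, hK⟩ := (fderiv ℝ f x).toLinearMap.exists_antilipschitzWith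
    (LinearMap.ker_eq_bot.2 (hinj x hxA))
  have hstrict := (hf x hxA).hasStrictFDerivAt one_ne_zero
  obtain ⟨u, hu, happ⟩ := hstrict.approximates_deriv_on_nhds (c := (2 * K)⁻¹)
    (Or.inr (by positivity))
  obtain ⟨ε, hε, hεu⟩ := Metric.nhds_basis_closedBall.mem_iff.1 hu
  refine ⟨A ∩ closedBall x ε, inter_subset_left, hA.inter_right isClosed_closedBall, ?_⟩
  set A' := A ∩ closedBall x ε
  have hA' : r < dimH A' := hx _ (inter_mem_nhdsWithin A (closedBall_mem_nhds x hε))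
  refine hA'.trans_le ?_
  have hanti : AntilipschitzWith (2 * K) (Set.domRestrict A' f) := by
    refine AntilipschitzWith.of_le_mul_dist fun a b => ?_
    have h1 := happ a.1 (hεu a.2.2) b.1 (hεu b.2.2)
    have h2 := hK.le_mul_dist (a : X) b
    rw [Subtype.dist_eq, Set.domRestrict_apply, Set.domRestrict_apply]
    rw [dist_eq_norm, dist_eq_norm] at h2 ⊢
    change _ ≤ _ * ‖fderiv ℝ f x a - fderiv ℝ f x b‖ at h2
    rw [← map_sub] at h2
    have h3 : ‖fderiv ℝ f x (a - b : X)‖ ≤ ‖f a - f b‖ + (2 * (K : ℝ))⁻¹ * ‖(a - b : X)‖ := by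
      have := norm_le_norm_add_norm_sub' (fderiv ℝ f x (a - b : X)) (f a - f b)
      rw [norm_sub_rev (fderiv ℝ f x (a - b : X))] at this
      push_cast at h1
      linarith
    have hK0' : (0 : ℝ) < K := hK0
    have h4 := h2.trans (mul_le_mul_of_nonneg_left h3 hK0'.le)
    have h5 : (K : ℝ) * (‖f a - f b‖ + (2 * (K : ℝ))⁻¹ * ‖(a - b : X)‖) =
        K * ‖f a - f b‖ + ‖(a - b : X)‖ / 2 := by
      field_simp
    push_cast
    linarith
  have h1 := hanti.le_dimH_image univ
  rw [image_univ, Set.range_domRestrict] at h1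
  rwa [← isometry_subtype_coe.dimH_image, image_univ, Subtype.range_coe] at h1

theorem injective_of_rank_eq_finrank {X Y : Type*} [AddCommGroup X] [Module ℝ X]
    [FiniteDimensional ℝ X] [AddCommGroup Y] [Module ℝ Y] (f : X →ₗ[ℝ] Y)
    (h : f.rank = (Module.finrank ℝ X : Cardinal)) : Function.Injective f := by
  have h1 : Module.finrank ℝ (LinearMap.range f) = Module.finrank ℝ X :=
    Module.finrank_eq_of_rank_eq h
  have h2 := f.finrank_range_add_finrank_ker
  rw [h1] at h2
  exact LinearMap.ker_eq_bot.1 (Submodule.finrank_eq_zero.1 (by omega))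

theorem exists_nnreal_lt_of_natCast_lt_add {a b : ℝ≥0∞} {n : ℕ} (ha : a ≤ n) (hb : b ≤ n)
    (h : (n : ℝ≥0∞) < a + b) :
    ∃ s t : ℝ≥0, 0 < s ∧ 0 < t ∧ (s : ℝ≥0∞) < a ∧ (t : ℝ≥0∞) < b ∧ (n : ℝ) < s + t := by
  lift a to ℝ≥0 using (ha.trans_lt (ENNReal.natCast_lt_top n)).ne
  lift b to ℝ≥0 using (hb.trans_lt (ENNReal.natCast_lt_top n)).ne
  have ha' : (a : ℝ) ≤ n := by exact_mod_cast ha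
  have hb' : (b : ℝ) ≤ n := by exact_mod_cast hb
  have h' : (n : ℝ) < a + b := by exact_mod_cast h
  set ε : ℝ := (a + b - n) / 3 with hε
  obtain ⟨s, hs⟩ : ∃ s : ℝ≥0, (s : ℝ) = a - ε := ⟨⟨a - ε, by linarith⟩, rfl⟩
  obtain ⟨t, ht⟩ : ∃ t : ℝ≥0, (t : ℝ) = b - ε := ⟨⟨b - ε, by linarith⟩, rfl⟩
  refine ⟨s, t, ?_, ?_, ?_, ?_, ?_⟩
  · exact NNReal.coe_lt_coe.1 (by rw [hs, NNReal.coe_zero]; linarith)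
  · exact NNReal.coe_lt_coe.1 (by rw [ht, NNReal.coe_zero]; linarith)
  · exact ENNReal.coe_lt_coe.2 (NNReal.coe_lt_coe.1 (by rw [hs]; linarith))
  · exact ENNReal.coe_lt_coe.2 (NNReal.coe_lt_coe.1 (by rw [ht]; linarith))
  · rw [hs, ht]; linarith

theorem volume_image_pos_of_const_mul {α : Type*} {f : α → ℝ} {A : Set α} {c : ℝ}
    (h : 0 < volume ((fun x => c * f x) '' A)) : 0 < volume (f '' A) := by
  have h1 : (fun x => c * f x) '' A = (c * ·) '' (f '' A) := by rw [image_image]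
  rw [h1] at h
  refine pos_iff_ne_zero.2 fun h0 => h.ne' ?_
  have := Measure.addHaar_image_linearMap volume (LinearMap.mulLeft ℝ c) (f '' A)
  rw [h0, mul_zero] at this
  exact this

end Projections

/-- If `Φ(x,y) = Σ P_k(x) Q_k(y)` with `P`, `ρ∘Q` smooth of maximal rank,
`A ⊆ U`, `B ⊆ V` compact and `dim_H A + dim_H B > n`, then for some `y ∈ B` the pinned image
`Δ_{Φ,y}(A)` has positive Lebesgue measure. -/
theorem stmt_0 (m n p : ℕ) (hm : 1 ≤ m) (hmn : m ≤ n) (hp : 1 ≤ p) (hpn : p ≤ n - 1)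
    (U : Set (EuclideanSpace ℝ (Fin m))) (V : Set (EuclideanSpace ℝ (Fin p)))
    (hU : IsOpen U) (hV : IsOpen V)
    (P : EuclideanSpace ℝ (Fin m) → EuclideanSpace ℝ (Fin n))
    (Q : EuclideanSpace ℝ (Fin p) → EuclideanSpace ℝ (Fin n))
    (hP : ContDiffOn ℝ (⊤ : ℕ∞) P U)
    (hQ : ContDiffOn ℝ (⊤ : ℕ∞) Q V)
    (hQ0 : ∀ y ∈ V, Q y ≠ 0)
    (hPrank : ∀ x ∈ U, LinearMap.rank (fderiv ℝ P x).toLinearMap = m)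
    (hQrank : ∀ y ∈ V,
      LinearMap.rank (fderiv ℝ (fun z => ‖Q z‖⁻¹ • Q z) y).toLinearMap = p)
    (A : Set (EuclideanSpace ℝ (Fin m))) (B : Set (EuclideanSpace ℝ (Fin p)))
    (hA : IsCompact A) (hB : IsCompact B) (hAU : A ⊆ U) (hBV : B ⊆ V)
    (hdim : dimH A + dimH B > (n : ℝ≥0∞)) :
    ∃ y ∈ B, 0 < volume ((fun x => ∑ k, P x k * Q y k) '' A) := by
  have hAn : dimH A ≤ n := by
    refine (dimH_mono (Set.subset_univ A)).trans ?_
    rw [Real.dimH_univ_eq_finrank, finrank_euclideanSpace_fin]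
    exact_mod_cast hmn
  have hBn : dimH B ≤ n := by
    refine (dimH_mono (Set.subset_univ B)).trans ?_
    rw [Real.dimH_univ_eq_finrank, finrank_euclideanSpace_fin]
    exact_mod_cast hpn.trans (Nat.sub_le n 1)
  obtain ⟨s, t, hs, ht, hsA, htB, hst⟩ := exists_nnreal_lt_of_natCast_lt_add hAn hBn hdim
  have hP1 : ∀ x ∈ A, ContDiffAt ℝ 1 P x := fun x hx =>
    (hP.contDiffAt (hU.mem_nhds (hAU hx))).of_le (by exact_mod_cast le_top)
  have hQ1 : ∀ y ∈ B, ContDiffAt ℝ 1 (fun z => ‖Q z‖⁻¹ • Q z) y := fun y hy => by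
    have hy0 := hQ0 y (hBV hy)
    have h : ContDiffAt ℝ 1 Q y :=
      (hQ.contDiffAt (hV.mem_nhds (hBV hy))).of_le (by exact_mod_cast le_top)
    exact ((h.norm ℝ hy0).inv (norm_ne_zero_iff.2 hy0)).smul h
  obtain ⟨A', hA'A, hA', hsA'⟩ := exists_isCompact_subset_lt_dimH_image hA hP1
    (fun x hx => injective_of_rank_eq_finrank (fderiv ℝ P x).toLinearMap
      ((hPrank x (hAU hx)).trans (by rw [finrank_euclideanSpace_fin]))) hsA
  obtain ⟨B', hB'B, hB', htB'⟩ := exists_isCompact_subset_lt_dimH_image hB hQ1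
    (fun y hy => injective_of_rank_eq_finrank (fderiv ℝ (fun z => ‖Q z‖⁻¹ • Q z) y).toLinearMap
      ((hQrank y (hBV hy)).trans (by rw [finrank_euclideanSpace_fin]))) htB
  have hE : IsCompact (P '' A') := hA'.image_of_continuousOn fun x hx =>
    (hP1 x (hA'A hx)).continuousAt.continuousWithinAt
  have hF : IsCompact ((fun z => ‖Q z‖⁻¹ • Q z) '' B') := hB'.image_of_continuousOn fun y hy =>
    (hQ1 y (hB'B hy)).continuousAt.continuousWithinAt
  have hF1 : ∀ θ ∈ (fun z => ‖Q z‖⁻¹ • Q z) '' B', ‖θ‖ = 1 := by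
    rintro _ ⟨y, hy, rfl⟩
    rw [norm_smul, norm_inv, norm_norm,
      inv_mul_cancel₀ (norm_ne_zero_iff.2 (hQ0 y (hBV (hB'B hy))))]
  obtain ⟨_, ⟨y, hy, rfl⟩, hpos⟩ := exists_pos_volume_inner_image hE hF hF1
    (NNReal.coe_pos.2 hs) (NNReal.coe_pos.2 ht) (by rwa [finrank_euclideanSpace_fin])
    (by rw [hausdorffMeasure_of_lt_dimH hsA']; exact ENNReal.top_ne_zero)
    (by rw [hausdorffMeasure_of_lt_dimH htB']; exact ENNReal.top_ne_zero)
  refine ⟨y, hB'B hy, ?_⟩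
  have hinner : (fun x => inner ℝ x (‖Q y‖⁻¹ • Q y)) '' (P '' A') =
      (fun x => ‖Q y‖⁻¹ * ∑ k, P x k * Q y k) '' A' := by
    rw [Set.image_image]
    refine Set.image_congr fun x _ => ?_
    rw [inner_smul_right, PiLp.inner_apply]
    simp [mul_comm]
  rw [hinner] at hpos
  exact (volume_image_pos_of_const_mul hpos).trans_le (measure_mono (Set.image_mono hA'A))
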